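/- Fix c₁ > 0 and c₀ ∈ ℝ, and let U⁻ := { s ∈ ℂ : Im s > 0 and Im J_{c₁,c₀}(s) < 0 }. Then J_{c₁,c₀} is injective on U⁻ and its image J_{c₁,c₀}(U⁻) equals the open horizontal strip { z ∈ ℂ : −π < Im z < 0 }. -/

import Mathlib

/-- The map `J_{c₁,c₀}(s) = c₁·s + c₀ − Log((s − 1/2)/(s + 1/2))`, with the principal branch of
the complex logarithm. -/
noncomputable def Jmap (c₁ c₀ : ℝ) (s : ℂ) : ℂ :=
  c₁ * s + c₀ - Complex.log ((s - 1/2) / (s + 1/2))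

/-- A mean value criterion for injectivity: if the real part of `k * f'` does not vanish on a
convex set, then `f` is injective there. -/
theorem injOn_of_convex_of_re_mul_deriv_ne_zero {f f' : ℂ → ℂ} {S : Set ℂ} (hS : Convex ℝ S)
    (k : ℂ) (hf : ∀ s ∈ S, HasDerivAt f (f' s) s) (hk : ∀ s ∈ S, (k * f' s).re ≠ 0) :
    Set.InjOn f S := by
  intro a ha b hb hab
  by_contra hne
  have hba : b - a ≠ 0 := sub_ne_zero.mpr (Ne.symm hne)
  have hmem : ∀ t ∈ Set.Icc (0 : ℝ) 1, a + (t : ℂ) * (b - a) ∈ S := fun t ht => by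
    simpa using hS.add_smul_sub_mem ha hb ht
  have hderiv : ∀ t ∈ Set.Icc (0 : ℝ) 1,
      HasDerivAt (fun t : ℝ => (k / (b - a) * f (a + (t : ℂ) * (b - a))).re)
        (k * f' (a + (t : ℂ) * (b - a))).re t := fun t ht => by
    have hline : HasDerivAt (fun z : ℂ => a + z * (b - a)) (b - a) (t : ℂ) := by
      simpa using ((hasDerivAt_id (t : ℂ)).mul_const (b - a)).const_add a
    have hcomp := ((hf _ (hmem t ht)).comp (t : ℂ) hline).const_mul (k / (b - a))
    have hmul : k / (b - a) * (f' (a + (t : ℂ) * (b - a)) * (b - a))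
        = k * f' (a + (t : ℂ) * (b - a)) := by
      field_simp
    rw [hmul] at hcomp
    exact hcomp.real_of_complex
  obtain ⟨t, ht, ht'⟩ := exists_hasDerivAt_eq_zero (zero_lt_one' ℝ)
    (fun t ht => (hderiv t ht).continuousAt.continuousWithinAt)
    (by simp [hab]) (fun t ht => hderiv t (Set.Ioo_subset_Icc_self ht))
  exact hk _ (hmem t (Set.Ioo_subset_Icc_self ht)) ht'

theorem add_half_ne_zero_of_im_pos {s : ℂ} (hs : 0 < s.im) : s + 1 / 2 ≠ 0 := fun h => by
  have := congrArg Complex.im h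
  norm_num at this
  linarith

theorem sub_half_ne_zero_of_im_pos {s : ℂ} (hs : 0 < s.im) : s - 1 / 2 ≠ 0 := fun h => by
  have := congrArg Complex.im h
  norm_num at this
  linarith

theorem im_sub_half_div_add_half (s : ℂ) :
    ((s - 1 / 2) / (s + 1 / 2)).im = s.im / Complex.normSq (s + 1 / 2) := by
  rw [Complex.div_im]
  norm_num
  ring

theorem im_sub_half_div_add_half_pos {s : ℂ} (hs : 0 < s.im) :
    0 < ((s - 1 / 2) / (s + 1 / 2)).im := by
  rw [im_sub_half_div_add_half]
  exact div_pos hs (Complex.normSq_pos.mpr (add_half_ne_zero_of_im_pos hs))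

theorem Jmap_im (c₁ c₀ : ℝ) (s : ℂ) :
    (Jmap c₁ c₀ s).im = c₁ * s.im - ((s - 1 / 2) / (s + 1 / 2)).arg := by
  simp [Jmap, Complex.log_im]

theorem Jmap_re (c₁ c₀ : ℝ) (s : ℂ) :
    (Jmap c₁ c₀ s).re = c₁ * s.re + c₀ - Real.log (‖s - 1 / 2‖ / ‖s + 1 / 2‖) := by
  simp [Jmap, Complex.log_re]

theorem hasDerivAt_Jmap (c₁ c₀ : ℝ) {s : ℂ} (hs : 0 < s.im) :
    HasDerivAt (Jmap c₁ c₀) (c₁ - 1 / (s ^ 2 - 1 / 4)) s := by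
  have h₁ := add_half_ne_zero_of_im_pos hs
  have h₂ := sub_half_ne_zero_of_im_pos hs
  have hlin : HasDerivAt (fun z : ℂ => (c₁ : ℂ) * z + c₀) c₁ s := by
    simpa using ((hasDerivAt_id s).const_mul (c₁ : ℂ)).add_const (c₀ : ℂ)
  have hquot := ((hasDerivAt_id s).sub_const (1 / 2 : ℂ)).div
    ((hasDerivAt_id s).add_const (1 / 2 : ℂ)) h₁
  have hlog := hquot.clog (Or.inr (im_sub_half_div_add_half_pos hs).ne')
  refine (hlin.sub hlog).congr_deriv ?_
  have h₃ : s ^ 2 - 1 / 4 = (s - 1 / 2) * (s + 1 / 2) := by ring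
  rw [h₃]
  simp only [id, Pi.div_apply]
  generalize hp : s + 1 / 2 = p at *
  generalize hq : s - 1 / 2 = q at *
  have : p - q = 1 := by rw [← hp, ← hq]; ring
  field_simp
  linear_combination -this

theorem norm_sub_half_sq (s : ℂ) : ‖s - 1 / 2‖ ^ 2 = (s.re - 1 / 2) ^ 2 + s.im ^ 2 := by
  rw [← Complex.normSq_eq_norm_sq, Complex.normSq_apply]
  norm_num
  ring

theorem norm_add_half_sq (s : ℂ) : ‖s + 1 / 2‖ ^ 2 = (s.re + 1 / 2) ^ 2 + s.im ^ 2 := by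
  rw [← Complex.normSq_eq_norm_sq, Complex.normSq_apply]
  norm_num
  ring

theorem Jmap_re_gt {c₁ : ℝ} (c₀ : ℝ) (hc₁ : 0 < c₁) {s : ℂ} (hs : 0 < s.im) (hx : 0 < s.re) :
    c₀ < (Jmap c₁ c₀ s).re := by
  have hp : 0 < ‖s + 1 / 2‖ := norm_pos_iff.mpr (add_half_ne_zero_of_im_pos hs)
  have hq : 0 < ‖s - 1 / 2‖ := norm_pos_iff.mpr (sub_half_ne_zero_of_im_pos hs)
  have hlt : ‖s - 1 / 2‖ < ‖s + 1 / 2‖ := by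
    apply lt_of_pow_lt_pow_left₀ 2 hp.le
    rw [norm_sub_half_sq, norm_add_half_sq]
    linarith
  have := Real.log_neg (div_pos hq hp) ((div_lt_one hp).mpr hlt)
  have := mul_pos hc₁ hx
  rw [Jmap_re]
  linarith

theorem Jmap_re_lt {c₁ : ℝ} (c₀ : ℝ) (hc₁ : 0 < c₁) {s : ℂ} (hs : 0 < s.im) (hx : s.re < 0) :
    (Jmap c₁ c₀ s).re < c₀ := by
  have hp : 0 < ‖s + 1 / 2‖ := norm_pos_iff.mpr (add_half_ne_zero_of_im_pos hs)
  have hq : 0 < ‖s - 1 / 2‖ := norm_pos_iff.mpr (sub_half_ne_zero_of_im_pos hs)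
  have hlt : ‖s + 1 / 2‖ < ‖s - 1 / 2‖ := by
    apply lt_of_pow_lt_pow_left₀ 2 hq.le
    rw [norm_sub_half_sq, norm_add_half_sq]
    linarith
  have := Real.log_pos ((one_lt_div hp).mpr hlt)
  have := mul_neg_of_pos_of_neg hc₁ hx
  rw [Jmap_re]
  linarith

theorem Jmap_re_eq (c₁ c₀ : ℝ) {s : ℂ} (hs : 0 < s.im) (hx : s.re = 0) :
    (Jmap c₁ c₀ s).re = c₀ := by
  have hp : 0 < ‖s + 1 / 2‖ := norm_pos_iff.mpr (add_half_ne_zero_of_im_pos hs)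
  have heq : ‖s - 1 / 2‖ = ‖s + 1 / 2‖ := by
    apply (pow_left_inj₀ (norm_nonneg _) hp.le two_ne_zero).mp
    rw [norm_sub_half_sq, norm_add_half_sq, hx]
    ring
  rw [Jmap_re, heq, div_self hp.ne', hx]
  simp

theorem sq_sub_quarter_ne_zero_of_im_pos {s : ℂ} (hs : 0 < s.im) : s ^ 2 - 1 / 4 ≠ 0 := by
  have h : s ^ 2 - 1 / 4 = (s - 1 / 2) * (s + 1 / 2) := by ring
  rw [h]
  exact mul_ne_zero (sub_half_ne_zero_of_im_pos hs) (add_half_ne_zero_of_im_pos hs)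

theorem re_I_mul_deriv_Jmap_ne_zero (c₁ : ℝ) {s : ℂ} (hs : 0 < s.im) (hx : s.re ≠ 0) :
    (Complex.I * (c₁ - 1 / (s ^ 2 - 1 / 4))).re ≠ 0 := by
  have h₀ := Complex.normSq_pos.mpr (sq_sub_quarter_ne_zero_of_im_pos hs)
  have h : (Complex.I * (c₁ - 1 / (s ^ 2 - 1 / 4))).re
      = -(2 * s.re * s.im) / Complex.normSq (s ^ 2 - 1 / 4) := by
    have h₄ : (s ^ 2 - 1 / 4).im = 2 * s.re * s.im := by
      norm_num [pow_two]
      ring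
    rw [Complex.I_mul_re, Complex.sub_im, Complex.ofReal_im, one_div (s ^ 2 - 1 / 4),
      Complex.inv_im, h₄]
    ring
  rw [h]
  exact div_ne_zero (neg_ne_zero.mpr (by positivity)) h₀.ne'

theorem re_deriv_Jmap_pos_of_re_eq_zero {c₁ : ℝ} (hc₁ : 0 < c₁) {s : ℂ} (hs : 0 < s.im)
    (hx : s.re = 0) : 0 < (c₁ - 1 / (s ^ 2 - 1 / 4) : ℂ).re := by
  have h₀ := Complex.normSq_pos.mpr (sq_sub_quarter_ne_zero_of_im_pos hs)
  have h₄ : (s ^ 2 - 1 / 4).re = -(s.im ^ 2 + 1 / 4) := by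
    norm_num [pow_two, hx]
    ring
  rw [Complex.sub_re, Complex.ofReal_re, one_div (s ^ 2 - 1 / 4), Complex.inv_re, h₄, neg_div,
    sub_neg_eq_add]
  positivity

theorem injOn_Jmap_upperHalfPlane {c₁ : ℝ} (c₀ : ℝ) (hc₁ : 0 < c₁) :
    Set.InjOn (Jmap c₁ c₀) {s : ℂ | 0 < s.im} := by
  have hconv : Convex ℝ {s : ℂ | 0 < s.im} := convex_halfSpace_im_gt 0
  have hpos : Set.InjOn (Jmap c₁ c₀) ({s : ℂ | 0 < s.im} ∩ {s : ℂ | 0 < s.re}) :=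
    injOn_of_convex_of_re_mul_deriv_ne_zero (hconv.inter (convex_halfSpace_re_gt 0)) Complex.I
      (fun s hs => hasDerivAt_Jmap c₁ c₀ hs.1)
      (fun s hs => re_I_mul_deriv_Jmap_ne_zero c₁ hs.1 (ne_of_gt hs.2))
  have hneg : Set.InjOn (Jmap c₁ c₀) ({s : ℂ | 0 < s.im} ∩ {s : ℂ | s.re < 0}) :=
    injOn_of_convex_of_re_mul_deriv_ne_zero (hconv.inter (convex_halfSpace_re_lt 0)) Complex.I
      (fun s hs => hasDerivAt_Jmap c₁ c₀ hs.1)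
      (fun s hs => re_I_mul_deriv_Jmap_ne_zero c₁ hs.1 (ne_of_lt hs.2))
  have haxis : Set.InjOn (Jmap c₁ c₀) ({s : ℂ | 0 < s.im} ∩ {s : ℂ | s.re = 0}) :=
    injOn_of_convex_of_re_mul_deriv_ne_zero
      (hconv.inter (convex_hyperplane Complex.reLm.isLinear 0)) 1
      (fun s hs => hasDerivAt_Jmap c₁ c₀ hs.1)
      (fun s hs => by
        rw [one_mul]
        exact (re_deriv_Jmap_pos_of_re_eq_zero hc₁ hs.1 hs.2).ne')
  intro a ha b hb hab
  have hre := congrArg Complex.re hab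
  rcases lt_trichotomy a.re 0 with h | h | h <;> rcases lt_trichotomy b.re 0 with h' | h' | h'
  · exact hneg ⟨ha, h⟩ ⟨hb, h'⟩ hab
  · linarith [Jmap_re_lt c₀ hc₁ ha h, Jmap_re_eq c₁ c₀ hb h']
  · linarith [Jmap_re_lt c₀ hc₁ ha h, Jmap_re_gt c₀ hc₁ hb h']
  · linarith [Jmap_re_eq c₁ c₀ ha h, Jmap_re_lt c₀ hc₁ hb h']
  · exact haxis ⟨ha, h⟩ ⟨hb, h'⟩ hab
  · linarith [Jmap_re_eq c₁ c₀ ha h, Jmap_re_gt c₀ hc₁ hb h']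
  · linarith [Jmap_re_gt c₀ hc₁ ha h, Jmap_re_lt c₀ hc₁ hb h']
  · linarith [Jmap_re_gt c₀ hc₁ ha h, Jmap_re_eq c₁ c₀ hb h']
  · exact hpos ⟨ha, h⟩ ⟨hb, h'⟩ hab

theorem isOpen_Jmap_im_neg (c₁ c₀ : ℝ) :
    IsOpen {s : ℂ | 0 < s.im ∧ (Jmap c₁ c₀ s).im < 0} := by
  have hcont : ContinuousOn (fun s => (Jmap c₁ c₀ s).im) {s : ℂ | 0 < s.im} := fun s hs =>
    (Complex.continuous_im.continuousAt.comp
      (hasDerivAt_Jmap c₁ c₀ hs).continuousAt).continuousWithinAt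
  exact hcont.isOpen_inter_preimage (isOpen_lt continuous_const Complex.continuous_im) isOpen_Iio

theorem isOpen_image_Jmap {c₁ : ℝ} (c₀ : ℝ) (hc₁ : 0 < c₁) :
    IsOpen (Jmap c₁ c₀ '' {s : ℂ | 0 < s.im ∧ (Jmap c₁ c₀ s).im < 0}) := by
  have hopen : IsOpen {s : ℂ | 0 < s.im} := isOpen_lt continuous_const Complex.continuous_im
  have han : AnalyticOnNhd ℂ (Jmap c₁ c₀) {s : ℂ | 0 < s.im} :=
    DifferentiableOn.analyticOnNhd
      (fun s hs => (hasDerivAt_Jmap c₁ c₀ hs).differentiableAt.differentiableWithinAt) hopen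
  rcases han.is_constant_or_isOpen (convex_halfSpace_im_gt 0).isPreconnected with ⟨w, hw⟩ | h
  · have h₁ : (0 : ℝ) < Complex.I.im := by simp
    have h₂ : (0 : ℝ) < (2 * Complex.I).im := by simp
    have := injOn_Jmap_upperHalfPlane c₀ hc₁ h₁ h₂ ((hw _ h₁).trans (hw _ h₂).symm)
    norm_num [Complex.ext_iff] at this
  · exact h _ (fun s hs => hs.1) (isOpen_Jmap_im_neg c₁ c₀)

theorem exists_Jmap_im_neg {c₁ : ℝ} (c₀ : ℝ) (hc₁ : 0 < c₁) :
    ∃ s : ℂ, 0 < s.im ∧ (Jmap c₁ c₀ s).im < 0 := by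
  obtain ⟨y, hy, hy₁, hy₂⟩ : ∃ y : ℝ, 0 < y ∧ y ≤ 1 / 2 ∧ c₁ * y ≤ 1 := by
    refine ⟨min (1 / 2) (1 / c₁), by positivity, min_le_left _ _, ?_⟩
    calc c₁ * min (1 / 2) (1 / c₁) ≤ c₁ * (1 / c₁) := by gcongr; exact min_le_right _ _
      _ = 1 := mul_one_div_cancel hc₁.ne'
  have him : 0 < (⟨0, y⟩ : ℂ).im := hy
  refine ⟨⟨0, y⟩, hy, ?_⟩
  have hu := im_sub_half_div_add_half_pos him
  have hre : (((⟨0, y⟩ : ℂ) - 1 / 2) / (⟨0, y⟩ + 1 / 2)).re ≤ 0 := by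
    have h₀ := Complex.normSq_pos.mpr (add_half_ne_zero_of_im_pos him)
    rw [Complex.div_re, ← add_div]
    refine div_nonpos_of_nonpos_of_nonneg ?_ h₀.le
    norm_num
    nlinarith
  have harg : Real.pi / 2 ≤ (((⟨0, y⟩ : ℂ) - 1 / 2) / (⟨0, y⟩ + 1 / 2)).arg := by
    by_contra! hlt
    rcases Complex.arg_lt_pi_div_two_iff.mp hlt with h | h | h
    · linarith
    · linarith
    · rw [h] at hu
      simp at hu
  rw [Jmap_im]
  show c₁ * y - _ < 0
  linarith [Real.pi_gt_three]

/-- Away from the unit disc the logarithmic term of `Jmap` is bounded. -/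
theorem norm_log_sub_half_div_add_half_le {s : ℂ} (hs : 1 ≤ ‖s‖) :
    ‖Complex.log ((s - 1 / 2) / (s + 1 / 2))‖ ≤ Real.log 3 + Real.pi := by
  have hhalf : ‖(1 / 2 : ℂ)‖ = 1 / 2 := by norm_num
  have hq := norm_sub_norm_le s (1 / 2)
  have hq' := norm_sub_le s (1 / 2)
  have hp := norm_sub_le_norm_add s (1 / 2)
  have hp' := norm_add_le s (1 / 2)
  rw [hhalf] at hq hq' hp hp'
  have hp₀ : 0 < ‖s + 1 / 2‖ := by linarith
  have hq₀ : 0 < ‖s - 1 / 2‖ := by linarith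
  have hre : |(Complex.log ((s - 1 / 2) / (s + 1 / 2))).re| ≤ Real.log 3 := by
    rw [Complex.log_re, norm_div, abs_le]
    constructor
    · rw [← Real.log_inv]
      apply Real.log_le_log (by norm_num)
      rw [le_div_iff₀ hp₀]
      linarith
    · apply Real.log_le_log (by positivity)
      rw [div_le_iff₀ hp₀]
      linarith
  have him : |(Complex.log ((s - 1 / 2) / (s + 1 / 2))).im| ≤ Real.pi := by
    rw [Complex.log_im]
    exact Complex.abs_arg_le_pi _
  exact (Complex.norm_le_abs_re_add_abs_im _).trans (add_le_add hre him)

theorem norm_le_of_norm_Jmap_le {c₁ : ℝ} (c₀ : ℝ) (hc₁ : 0 < c₁) {s : ℂ} {R : ℝ}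
    (hR : ‖Jmap c₁ c₀ s‖ ≤ R) : ‖s‖ ≤ max 1 ((R + |c₀| + (Real.log 3 + Real.pi)) / c₁) := by
  rcases le_total ‖s‖ 1 with h | h
  · exact le_max_of_le_left h
  · apply le_max_of_le_right
    rw [le_div_iff₀ hc₁]
    have heq : (c₁ : ℂ) * s
        = Jmap c₁ c₀ s - c₀ + Complex.log ((s - 1 / 2) / (s + 1 / 2)) := by
      rw [Jmap]
      ring
    have h₁ := norm_add_le (Jmap c₁ c₀ s - c₀) (Complex.log ((s - 1 / 2) / (s + 1 / 2)))
    have h₂ := norm_sub_le (Jmap c₁ c₀ s) c₀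
    rw [← heq, norm_mul, Complex.norm_real, Real.norm_of_nonneg hc₁.le] at h₁
    rw [Complex.norm_real, Real.norm_eq_abs] at h₂
    linarith [norm_log_sub_half_div_add_half_le h]

theorem closure_image_Jmap_inter_strip_subset {c₁ : ℝ} (c₀ : ℝ) (hc₁ : 0 < c₁) :
    closure (Jmap c₁ c₀ '' {s : ℂ | 0 < s.im ∧ (Jmap c₁ c₀ s).im < 0})
      ∩ {z : ℂ | -Real.pi < z.im ∧ z.im < 0}
      ⊆ Jmap c₁ c₀ '' {s : ℂ | 0 < s.im ∧ (Jmap c₁ c₀ s).im < 0} := by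
  rintro z ⟨hz, hzpi, hz0⟩
  obtain ⟨v, hv, hvz⟩ := mem_closure_iff_seq_limit.mp hz
  choose s hs hsv using hv
  obtain ⟨R, hR⟩ := (Metric.isBounded_range_of_tendsto v hvz).exists_norm_le
  have hbound : ∀ n, s n ∈ Metric.closedBall (0 : ℂ)
      (max 1 ((R + |c₀| + (Real.log 3 + Real.pi)) / c₁)) := fun n => by
    rw [mem_closedBall_zero_iff]
    apply norm_le_of_norm_Jmap_le c₀ hc₁
    rw [hsv]
    exact hR _ (Set.mem_range_self n)
  obtain ⟨σ, -, φ, hφ, hσ⟩ := (isCompact_closedBall _ _).tendsto_subseq hbound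
  set w : ℂ := c₁ * σ + c₀ - z with hw
  have hexp : ∀ n, Complex.exp (c₁ * s (φ n) + c₀ - v (φ n)) * (s (φ n) + 1 / 2)
      = s (φ n) - 1 / 2 := fun n => by
    have hpos := (hs (φ n)).1
    have hp := add_half_ne_zero_of_im_pos hpos
    rw [← hsv, Jmap, sub_sub_cancel,
      Complex.exp_log (div_ne_zero (sub_half_ne_zero_of_im_pos hpos) hp), div_mul_cancel₀ _ hp]
  have hlim : Filter.Tendsto (fun n => c₁ * s (φ n) + c₀ - v (φ n)) Filter.atTop (nhds w) :=
    ((hσ.const_mul _).add_const _).sub (hvz.comp hφ.tendsto_atTop)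
  have hlimit : Complex.exp w * (σ + 1 / 2) = σ - 1 / 2 := by
    refine tendsto_nhds_unique (((Complex.continuous_exp.tendsto w).comp hlim).mul
      (hσ.add_const _)) ((hσ.sub_const (1 / 2)).congr fun n => ?_)
    exact (hexp n).symm
  have hσim : 0 ≤ σ.im :=
    ge_of_tendsto' ((Complex.continuous_im.tendsto σ).comp hσ) fun n => (hs (φ n)).1.le
  have hwle : w.im ≤ Real.pi := by
    refine le_of_tendsto' ((Complex.continuous_im.tendsto w).comp hlim) fun n => ?_
    simp only [Function.comp_apply]
    rw [← hsv, Jmap, sub_sub_cancel, Complex.log_im]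
    exact Complex.arg_le_pi _
  have hwim : w.im = c₁ * σ.im - z.im := by simp [hw]
  have hwpos : 0 < w.im := by
    have := mul_nonneg hc₁.le hσim
    linarith
  have hp : σ + 1 / 2 ≠ 0 := fun h => by
    have h' : σ = -1 / 2 := by linear_combination h
    rw [h, h'] at hlimit
    norm_num at hlimit
  have hquot : (σ - 1 / 2) / (σ + 1 / 2) = Complex.exp w := by
    rw [← hlimit, mul_div_cancel_right₀ _ hp]
  have hσpos : 0 < σ.im := by
    refine hσim.lt_of_ne fun h => ?_
    have hsin : 0 < Real.sin w.im := Real.sin_pos_of_pos_of_lt_pi hwpos (by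
      rw [hwim, ← h]
      linarith)
    have him : (Complex.exp w).im = 0 := by
      rw [← hquot, im_sub_half_div_add_half, ← h, zero_div]
    rw [Complex.exp_im] at him
    exact (mul_pos (Real.exp_pos _) hsin).ne' him
  have hJ : Jmap c₁ c₀ σ = z := by
    rw [Jmap, hquot, Complex.log_exp (by linarith [Real.pi_pos]) hwle, hw]
    ring
  exact ⟨σ, ⟨hσpos, hJ ▸ hz0⟩, hJ⟩

theorem image_Jmap_subset_strip {c₁ : ℝ} (c₀ : ℝ) (hc₁ : 0 < c₁) :
    Jmap c₁ c₀ '' {s : ℂ | 0 < s.im ∧ (Jmap c₁ c₀ s).im < 0}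
      ⊆ {z : ℂ | -Real.pi < z.im ∧ z.im < 0} := by
  rintro _ ⟨s, ⟨hs, hJ⟩, rfl⟩
  refine ⟨?_, hJ⟩
  rw [Jmap_im]
  linarith [mul_pos hc₁ hs, Complex.arg_le_pi ((s - 1 / 2) / (s + 1 / 2))]

theorem strip_subset_image_Jmap {c₁ : ℝ} (c₀ : ℝ) (hc₁ : 0 < c₁) :
    {z : ℂ | -Real.pi < z.im ∧ z.im < 0}
      ⊆ Jmap c₁ c₀ '' {s : ℂ | 0 < s.im ∧ (Jmap c₁ c₀ s).im < 0} := by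
  have hconv : Convex ℝ {z : ℂ | -Real.pi < z.im ∧ z.im < 0} :=
    (convex_halfSpace_im_gt _).inter (convex_halfSpace_im_lt 0)
  obtain ⟨s, hs⟩ := exists_Jmap_im_neg c₀ hc₁
  have hmem : Jmap c₁ c₀ s ∈ Jmap c₁ c₀ '' {s : ℂ | 0 < s.im ∧ (Jmap c₁ c₀ s).im < 0} :=
    ⟨s, hs, rfl⟩
  exact hconv.isPreconnected.subset_of_closure_inter_subset (isOpen_image_Jmap c₀ hc₁)
    ⟨_, image_Jmap_subset_strip c₀ hc₁ hmem, hmem⟩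
    (closure_image_Jmap_inter_strip_subset c₀ hc₁)

/-- On `U⁻ = {s : Im s > 0, Im J(s) < 0}`, the map `J_{c₁,c₀}` is injective and
its image is the open strip `{z : −π < Im z < 0}`. -/
theorem Jmap_univalent_inside
    (c₁ c₀ : ℝ) (hc₁ : 0 < c₁) :
    Set.InjOn (Jmap c₁ c₀) {s : ℂ | 0 < s.im ∧ (Jmap c₁ c₀ s).im < 0} ∧
    Jmap c₁ c₀ '' {s : ℂ | 0 < s.im ∧ (Jmap c₁ c₀ s).im < 0}
      = {z : ℂ | -Real.pi < z.im ∧ z.im < 0} := by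
  exact ⟨(injOn_Jmap_upperHalfPlane c₀ hc₁).mono fun s hs => hs.1,
    (image_Jmap_subset_strip c₀ hc₁).antisymm (strip_subset_image_Jmap c₀ hc₁)⟩
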